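/- An element x ∈ gl(n+1,ℂ) is strongly regular (i.e., the differentials of the Gelfand-Zeitlin functions f_{i,j}(x) = Tr(x_i^j), 1 ≤ j ≤ i ≤ n+1, are linearly independent at x) if and only if x_i is regular in gl(i,ℂ) for all 1 ≤ i ≤ n+1 and z_{gl(i)}(x_i) ∩ z_{gl(i+1)}(x_{i+1}) = 0 for all 1 ≤ i ≤ n. -/

import Mathlib

open Matrix

/-- The centralizer of a matrix, as a submodule of the matrix algebra. -/
noncomputable def matCentralizer {m : Type*} [Fintype m] [DecidableEq m] (x : Matrix m m ℂ) :
    Submodule ℂ (Matrix m m ℂ) where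
  carrier := {y | x * y = y * x}
  add_mem' := by
    intro a b ha hb
    simp only [Set.mem_setOf_eq] at *
    rw [Matrix.mul_add, Matrix.add_mul, ha, hb]
  zero_mem' := by simp
  smul_mem' := by
    intro c a ha
    simp only [Set.mem_setOf_eq] at *
    rw [Matrix.mul_smul, Matrix.smul_mul, ha]

/-- The upper-left `k × k` corner of an `m × m` matrix. -/
def ulCorner {m k : ℕ} (h : k ≤ m) (x : Matrix (Fin m) (Fin m) ℂ) :
    Matrix (Fin k) (Fin k) ℂ :=
  x.submatrix (Fin.castLE h) (Fin.castLE h)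

/-- The embedding of `gl(m)` into `gl(m+1)` with last row and column zero. -/
def matEmbed {m : ℕ} (z : Matrix (Fin m) (Fin m) ℂ) :
    Matrix (Fin (m + 1)) (Fin (m + 1)) ℂ :=
  Matrix.of fun a b =>
    if ha : (a : ℕ) < m then (if hb : (b : ℕ) < m then z ⟨a, ha⟩ ⟨b, hb⟩ else 0) else 0

attribute [local instance] Matrix.normedAddCommGroup Matrix.normedSpace

open Polynomial in
lemma gz_decomp {V : Type} [AddCommGroup V] [Module ℂ V] [Module.Finite ℂ V]
    (f : Module.End ℂ V) :
    ∃ (ι : Type) (_ : Fintype ι) (_ : DecidableEq ι) (q : ι → ℂ[X]) (_ : ∀ i, q i ≠ 0)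
      (φ : V ≃ₗ[ℂ] (∀ i, ℂ[X] ⧸ Ideal.span {q i})),
      ∀ (r : ℂ[X]) (v : V), φ (aeval f r v) = r • φ v := by
  classical
  obtain ⟨ι, hι, p, hp, e, ⟨E⟩⟩ := Module.equiv_directSum_of_isTorsion
    (R := ℂ[X]) (M := Module.AEval ℂ V f) (Module.AEval.isTorsion_of_finiteDimensional ℂ V f)
  let E2 := E.trans (DirectSum.linearEquivFunOnFintype ℂ[X] ι _)
  refine ⟨ι, hι, inferInstance, fun i => p i ^ e i, fun i => pow_ne_zero _ (hp i).ne_zero,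
    (Module.AEval.of ℂ V f).trans (E2.restrictScalars ℂ), ?_⟩
  intro r v
  have : Module.AEval.of ℂ V f (aeval f r v) = r • Module.AEval.of ℂ V f v :=
    Module.AEval.of_aeval_smul f r v
  simp only [LinearEquiv.trans_apply, LinearEquiv.restrictScalars_apply]
  rw [this, map_smul]

lemma gz_mem {m : Type*} [Fintype m] [DecidableEq m] (x y : Matrix m m ℂ) :
    y ∈ matCentralizer x ↔ x * y = y * x := Iff.rfl

lemma gz_pow_mem {m : ℕ} (x : Matrix (Fin m) (Fin m) ℂ) (j : ℕ) :
    x ^ j ∈ matCentralizer x := by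
  rw [gz_mem, ← pow_succ, ← pow_succ']

lemma gz_aeval_mulVec {m : ℕ} (x : Matrix (Fin m) (Fin m) ℂ) (r : Polynomial ℂ)
    (v : Fin m → ℂ) :
    Polynomial.aeval (Matrix.toLinAlgEquiv' x) r v = (Polynomial.aeval x r) *ᵥ v := by
  rw [Polynomial.aeval_algEquiv]
  simp

open Polynomial in
lemma gz_LI_to_finrank {m : ℕ} (x : Matrix (Fin m) (Fin m) ℂ)
    (h : LinearIndependent ℂ (fun j : Fin m => x ^ (j : ℕ))) :
    Module.finrank ℂ (matCentralizer x) = m := by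
  obtain ⟨ι, _, _, q, hq, φ, hφ⟩ := gz_decomp (Matrix.toLinAlgEquiv' x)
  set v : Fin m → ℂ := φ.symm 1 with hv
  -- annihilator of v is the annihilator of everything
  have hann : ∀ r : ℂ[X], (aeval x r) *ᵥ v = 0 → aeval x r = 0 := by
    intro r hr
    have h1 : r • (1 : ∀ i, ℂ[X] ⧸ Ideal.span {q i}) = 0 := by
      have := hφ r v
      rw [gz_aeval_mulVec, hr, map_zero, hv, LinearEquiv.apply_symm_apply] at this
      exact this.symm
    have h2 : ∀ w : Fin m → ℂ, (aeval x r) *ᵥ w = 0 := by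
      intro w
      apply φ.injective
      rw [← gz_aeval_mulVec, hφ, map_zero]
      calc r • φ w = (r • (1 : ∀ i, ℂ[X] ⧸ Ideal.span {q i})) * φ w := by
            rw [smul_mul_assoc, one_mul]
        _ = 0 := by rw [h1, zero_mul]
    exact Matrix.ext_of_mulVec_single fun i => by rw [h2, Matrix.zero_mulVec]
  have hLI : LinearIndependent ℂ (fun j : Fin m => (x ^ (j : ℕ)) *ᵥ v) := by
    rw [Fintype.linearIndependent_iff] at h ⊢
    intro g hg
    apply h g
    have := hann (∑ j : Fin m, C (g j) * X ^ (j : ℕ))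
    simp only [map_sum, map_mul, aeval_C, map_pow, aeval_X] at this
    simp only [← Algebra.smul_def] at this
    apply this
    rw [Matrix.sum_mulVec]
    simpa [Matrix.smul_mulVec] using hg
  have hspan := hLI.span_eq_top_of_card_eq_finrank' (by simp)
  have hle : Module.finrank ℂ (matCentralizer x) ≤ m := by
    let T : matCentralizer x →ₗ[ℂ] (Fin m → ℂ) :=
      { toFun := fun z => z.1 *ᵥ v
        map_add' := by intro a b; simp [Matrix.add_mulVec]
        map_smul' := by intro a b; simp [Matrix.smul_mulVec] }
    have hT : Function.Injective T := by
      rw [injective_iff_map_eq_zero]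
      rintro ⟨z, hz⟩ h0
      have h0 : z *ᵥ v = 0 := h0
      have hz0 : Matrix.mulVecLin z = 0 := by
        apply LinearMap.ext_on_range hspan
        intro j
        have hc : x ^ (j : ℕ) * z = z * x ^ (j : ℕ) :=
          (Commute.pow_left (show Commute x z from hz) j).eq
        simp only [Matrix.mulVecLin_apply, Matrix.mulVec_mulVec, LinearMap.zero_apply]
        rw [← hc, ← Matrix.mulVec_mulVec, h0, Matrix.mulVec_zero]
      ext1
      exact Matrix.toLin'.injective (hz0.trans (map_zero _).symm)
    simpa using LinearMap.finrank_le_finrank_of_injective hT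
  have hge : m ≤ Module.finrank ℂ (matCentralizer x) := by
    have : LinearIndependent ℂ (fun j : Fin m => (⟨x ^ (j : ℕ), gz_pow_mem x j⟩ : matCentralizer x)) := by
      apply LinearIndependent.of_comp (matCentralizer x).subtype
      exact h
    simpa using this.fintype_card_le_finrank
  omega

lemma gz_span {m : ℕ} (x : Matrix (Fin m) (Fin m) ℂ)
    (h : LinearIndependent ℂ (fun j : Fin m => x ^ (j : ℕ))) :
    Submodule.span ℂ (Set.range (fun j : Fin m => x ^ (j : ℕ))) = matCentralizer x := by
  apply Submodule.eq_of_le_of_finrank_eq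
  · rw [Submodule.span_le]
    rintro _ ⟨j, rfl⟩
    exact gz_pow_mem x j
  · rw [finrank_span_eq_card h, gz_LI_to_finrank x h, Fintype.card_fin]

open Polynomial in
lemma gz_finrank_to_LI {m : ℕ} (x : Matrix (Fin m) (Fin m) ℂ)
    (h : Module.finrank ℂ (matCentralizer x) = m) :
    LinearIndependent ℂ (fun j : Fin m => x ^ (j : ℕ)) := by
  obtain ⟨ι, _, _, q, hq, φ, hφ⟩ := gz_decomp (Matrix.toLinAlgEquiv' x)
  -- maps commuting with X give elements of the centralizer
  have hcomm : ∀ g : (∀ i, ℂ[X] ⧸ Ideal.span {q i}) →ₗ[ℂ[X]] (∀ i, ℂ[X] ⧸ Ideal.span {q i}),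
      LinearMap.toMatrix' (φ.symm.toLinearMap ∘ₗ g.restrictScalars ℂ ∘ₗ φ.toLinearMap)
        ∈ matCentralizer x := by
    intro g
    rw [gz_mem]
    apply Matrix.toLin'.injective
    rw [Matrix.toLin'_mul, Matrix.toLin'_mul, Matrix.toLin'_toMatrix']
    have hX : ∀ w, φ (Matrix.toLin' x w) = (X : ℂ[X]) • φ w := by
      intro w
      have := hφ X w
      rw [aeval_X] at this
      exact this
    refine LinearMap.ext fun w => ?_
    simp only [LinearMap.comp_apply, LinearEquiv.coe_coe, LinearMap.restrictScalars_apply]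
    apply φ.injective
    rw [hX, LinearEquiv.apply_symm_apply, LinearEquiv.apply_symm_apply, hX, map_smul]
  let D : (∀ i, ℂ[X] ⧸ Ideal.span {q i}) →ₗ[ℂ] matCentralizer x :=
    { toFun := fun a => ⟨_, hcomm (LinearMap.mulLeft ℂ[X] a)⟩
      map_add' := by
        intro a b
        ext1
        simp only [Submodule.coe_add, ← map_add]
        congr 1
        refine LinearMap.ext fun w => ?_
        simp [add_mul]
      map_smul' := by
        intro a b
        ext1
        simp only [Submodule.coe_smul, ← map_smul, RingHom.id_apply]
        congr 1
        refine LinearMap.ext fun w => ?_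
        simp only [LinearMap.comp_apply, LinearEquiv.coe_coe, LinearMap.restrictScalars_apply,
          LinearMap.smul_apply, LinearMap.mulLeft_apply]
        rw [← map_smul]
        congr 1
        funext i
        exact Algebra.smul_mul_assoc a (b i) (φ w i) }
  have hDapp : ∀ a w, Matrix.toLin' (D a).1 w = φ.symm (a * φ w) := by
    intro a w
    change Matrix.toLin' (LinearMap.toMatrix' _) w = _
    rw [Matrix.toLin'_toMatrix']
    rfl
  have hDinj : Function.Injective D := by
    rw [injective_iff_map_eq_zero]
    intro a ha
    have := hDapp a (φ.symm 1)
    rw [ha] at this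
    simpa using this.symm
  have : Module.Finite ℂ (∀ i, ℂ[X] ⧸ Ideal.span {q i}) := Module.Finite.equiv φ
  have hfr : Module.finrank ℂ (∀ i, ℂ[X] ⧸ Ideal.span {q i}) = m := by
    rw [← φ.finrank_eq]; simp
  have hDsurj : Function.Surjective D :=
    (LinearMap.injective_iff_surjective_of_finrank_eq_finrank (by rw [hfr, h])).1 hDinj
  have hcop : Pairwise fun i j => IsCoprime (q i) (q j) := by
    intro i j hij
    by_contra hnc
    let g := EuclideanDomain.gcd (q i) (q j)
    have hg : ¬ IsUnit g := fun hu => hnc (EuclideanDomain.gcd_isUnit_iff.1 hu)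
    obtain ⟨a, ha⟩ : g ∣ q i := EuclideanDomain.gcd_dvd_left _ _
    obtain ⟨b, hb⟩ : g ∣ q j := EuclideanDomain.gcd_dvd_right _ _
    let hh : (ℂ[X] ⧸ Ideal.span {q i}) →ₗ[ℂ[X]] (ℂ[X] ⧸ Ideal.span {q j}) :=
      Submodule.liftQ _ (LinearMap.toSpanSingleton ℂ[X] _ (Ideal.Quotient.mk (Ideal.span {q j}) b)) (by
        rw [Ideal.span, Submodule.span_le]
        rintro _ rfl
        simp only [SetLike.mem_coe, LinearMap.mem_ker, LinearMap.toSpanSingleton_apply]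
        change Ideal.Quotient.mk (Ideal.span {q j}) (q i * b) = 0
        rw [Ideal.Quotient.eq_zero_iff_mem, Ideal.mem_span_singleton]
        exact ⟨a, by rw [ha, hb]; ring⟩)
    have hh1 : hh 1 = Ideal.Quotient.mk (Ideal.span {q j}) b := by
      change (1 : ℂ[X]) • Ideal.Quotient.mk (Ideal.span {q j}) b = _
      rw [one_smul]
    obtain ⟨d, hd⟩ := hDsurj ⟨_, hcomm (LinearMap.single ℂ[X] _ j ∘ₗ hh ∘ₗ LinearMap.proj i)⟩
    have h1 := hDapp d (φ.symm (Pi.single i 1))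
    rw [hd] at h1
    rw [Matrix.toLin'_toMatrix'] at h1
    have h2 := congrFun (φ.symm.injective h1) j
    simp [Pi.single_eq_of_ne hij.symm] at h2
    rw [hh1, Ideal.Quotient.eq_zero_iff_mem, Ideal.mem_span_singleton] at h2
    obtain ⟨c, hc⟩ := h2
    apply hg
    have hb0 : b ≠ 0 := by
      rintro rfl
      exact hq j (by rw [hb, mul_zero])
    refine IsUnit.of_mul_eq_one c (mul_left_cancel₀ hb0 ?_)
    rw [mul_one]
    nth_rewrite 2 [hc]
    rw [hb]; ring
  have hdeg : (∏ i, q i).natDegree = m := by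
    rw [natDegree_prod _ _ (fun i _ => hq i), ← hfr]
    have : ∀ i, Module.Finite ℂ (ℂ[X] ⧸ Ideal.span {q i}) := fun i =>
      Module.Finite.of_surjective (LinearMap.proj (R := ℂ) (φ := fun i => ℂ[X] ⧸ Ideal.span {q i}) i)
        (Function.surjective_eval i)
    rw [Module.finrank_pi_fintype]
    refine Finset.sum_congr rfl fun i _ => ?_
    exact finrank_quotient_span_eq_natDegree.symm
  have hdvd : (∏ i, q i) ∣ minpoly ℂ x := by
    apply Finset.prod_dvd_of_coprime (fun i _ j _ hij => hcop hij)
    intro i _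
    have := hφ (minpoly ℂ x) (φ.symm 1)
    rw [gz_aeval_mulVec, minpoly.aeval, Matrix.zero_mulVec, map_zero, LinearEquiv.apply_symm_apply] at this
    have := congrFun this i
    simp only [Pi.zero_apply, Pi.smul_apply, Pi.one_apply] at this
    have h2 : Ideal.Quotient.mk (Ideal.span {q i}) (minpoly ℂ x * 1) = 0 := this.symm
    rwa [mul_one, Ideal.Quotient.eq_zero_iff_mem, Ideal.mem_span_singleton] at h2
  have hle := natDegree_le_of_dvd hdvd (minpoly.ne_zero_of_finite ℂ x)
  rw [hdeg] at hle
  exact (linearIndependent_pow x).comp (Fin.castLE hle) (Fin.castLE_injective hle)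

/-- The matrix of the inclusion of the first `k` coordinates. -/
def gzJ {m k : ℕ} (h : k ≤ m) : Matrix (Fin m) (Fin k) ℂ :=
  (1 : Matrix (Fin m) (Fin m) ℂ).submatrix id (Fin.castLE h)

lemma gz_corner {m k : ℕ} (h : k ≤ m) (x : Matrix (Fin m) (Fin m) ℂ) :
    ulCorner h x = (gzJ h)ᵀ * x * gzJ h := by
  ext a b
  simp [ulCorner, gzJ, Matrix.mul_apply, Matrix.one_apply, Finset.sum_ite_eq]

lemma gz_JJ {m k : ℕ} (h : k ≤ m) : (gzJ h)ᵀ * gzJ h = 1 := by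
  ext a b
  simp [gzJ, Matrix.mul_apply, Matrix.one_apply, (Fin.castLE_injective h).eq_iff]

lemma gz_J_comp {m k l : ℕ} (h : k ≤ m) (h' : l ≤ k) :
    gzJ h * gzJ h' = gzJ (h'.trans h) := by
  ext a b
  simp [gzJ, Matrix.mul_apply, Matrix.one_apply]

lemma gz_embed {k : ℕ} (z : Matrix (Fin k) (Fin k) ℂ) :
    matEmbed z = gzJ (Nat.le_succ k) * z * (gzJ (Nat.le_succ k))ᵀ := by
  have key : ∀ a : Fin (k+1), ∀ b : Fin k, gzJ (Nat.le_succ k) a b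
      = if (a : ℕ) = b then 1 else 0 := by
    intro a b
    simp [gzJ, Matrix.one_apply, Fin.ext_iff]
  ext a b
  simp only [Matrix.mul_apply, Matrix.transpose_apply, key, matEmbed, Matrix.of_apply]
  have e : ∀ (a : Fin (k+1)) (f : Fin k → ℂ), (∑ j : Fin k, if (a : ℕ) = j then f j else 0) =
      if ha : (a : ℕ) < k then f ⟨a, ha⟩ else 0 := by
    intro a f
    split_ifs with ha
    · rw [Finset.sum_eq_single ⟨a, ha⟩]
      · simp
      · intro b _ hb
        rw [if_neg]
        intro h; exact hb (Fin.ext h.symm)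
      · simp
    · apply Finset.sum_eq_zero
      intro j _
      rw [if_neg]; have := j.isLt; omega
  simp only [ite_mul, one_mul, zero_mul, mul_ite, mul_one, mul_zero, e]
  split_ifs <;> rfl

/-- embedding of `gl(k)` in `gl(m)` -/
def gzE {m k : ℕ} (h : k ≤ m) : Matrix (Fin k) (Fin k) ℂ →ₗ[ℂ] Matrix (Fin m) (Fin m) ℂ where
  toFun z := gzJ h * z * (gzJ h)ᵀ
  map_add' := by intro a b; rw [Matrix.mul_add, Matrix.add_mul]
  map_smul' := by intro a b; simp

lemma gzE_apply {m k : ℕ} (h : k ≤ m) (z : Matrix (Fin k) (Fin k) ℂ) :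
    gzE h z = gzJ h * z * (gzJ h)ᵀ := rfl

lemma gzE_inj {m k : ℕ} (h : k ≤ m) : Function.Injective (gzE h) := by
  intro a b hab
  have : (gzJ h)ᵀ * gzE h a * gzJ h = (gzJ h)ᵀ * gzE h b * gzJ h := by rw [hab]
  have key : ∀ a, (gzJ h)ᵀ * gzE h a * gzJ h = a := by
    intro a
    calc (gzJ h)ᵀ * gzE h a * gzJ h = ((gzJ h)ᵀ * gzJ h) * a * ((gzJ h)ᵀ * gzJ h) := by
          simp only [gzE_apply, Matrix.mul_assoc]
      _ = a := by rw [gz_JJ, Matrix.one_mul, Matrix.mul_one]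
  rwa [key, key] at this

lemma gzE_comp {m k l : ℕ} (h : k ≤ m) (h' : l ≤ k) (z) :
    gzE h (gzE h' z) = gzE (h'.trans h) z := by
  simp only [gzE_apply, ← gz_J_comp h h', Matrix.transpose_mul, Matrix.mul_assoc]

lemma gz_trace {m k : ℕ} (h : k ≤ m) (z : Matrix (Fin k) (Fin k) ℂ) (v : Matrix (Fin m) (Fin m) ℂ) :
    (gzE h z * v).trace = (z * ulCorner h v).trace := by
  rw [gzE_apply, gz_corner, Matrix.mul_assoc, Matrix.mul_assoc, Matrix.trace_mul_comm]
  simp only [Matrix.mul_assoc]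

/-- corner of a bracket, larger `i` -/
lemma gz_bracket_large {m k i : ℕ} (hi : i ≤ m) (hk : k ≤ i) (x : Matrix (Fin m) (Fin m) ℂ)
    (z : Matrix (Fin i) (Fin i) ℂ) (hz : ulCorner hi x * z = z * ulCorner hi x) :
    ulCorner (hk.trans hi) (gzE hi z * x - x * gzE hi z) = 0 := by
  have : ulCorner (hk.trans hi) (gzE hi z * x - x * gzE hi z) =
      (gzJ hk)ᵀ * (((gzJ hi)ᵀ * gzJ hi) * (z * ulCorner hi x) - ulCorner hi x * z * ((gzJ hi)ᵀ * gzJ hi))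
        * gzJ hk := by
    simp only [gz_corner, gzE_apply, ← gz_J_comp hi hk, Matrix.transpose_mul, Matrix.mul_assoc,
      Matrix.mul_sub, Matrix.sub_mul]
  rw [this, gz_JJ, Matrix.one_mul, Matrix.mul_one, hz]
  simp

lemma gz_bracket_small {m k i : ℕ} (hk : k ≤ m) (hi : i ≤ k) (x : Matrix (Fin m) (Fin m) ℂ)
    (z : Matrix (Fin i) (Fin i) ℂ) :
    ulCorner hk (gzE (hi.trans hk) z * x - x * gzE (hi.trans hk) z) =
      gzE hi z * ulCorner hk x - ulCorner hk x * gzE hi z := by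
  have : ulCorner hk (gzE (hi.trans hk) z * x - x * gzE (hi.trans hk) z) =
      ((gzJ hk)ᵀ * gzJ hk) * gzE hi z * ulCorner hk x
        - ulCorner hk x * gzE hi z * ((gzJ hk)ᵀ * gzJ hk) := by
    simp only [gz_corner, gzE_apply, ← gz_J_comp hk hi, Matrix.transpose_mul, Matrix.mul_assoc,
      Matrix.mul_sub, Matrix.sub_mul]
  rw [this, gz_JJ, Matrix.one_mul, Matrix.mul_one]

lemma gz_main (n : ℕ) (x : Matrix (Fin (n + 1)) (Fin (n + 1)) ℂ) :
    LinearIndependent ℂ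
      (fun p : Σ i : Fin (n + 1), Fin ((i : ℕ) + 1) =>
        gzE p.1.isLt (ulCorner p.1.isLt x ^ (p.2 : ℕ))) ↔
    ((∀ i : Fin (n + 1), LinearIndependent ℂ
        (fun j : Fin ((i : ℕ) + 1) => ulCorner i.isLt x ^ (j : ℕ))) ∧
      ∀ i : Fin n, ∀ z : Matrix (Fin ((i : ℕ) + 1)) (Fin ((i : ℕ) + 1)) ℂ,
        z * ulCorner (Nat.succ_le_succ i.isLt.le) x =
          ulCorner (Nat.succ_le_succ i.isLt.le) x * z →
        matEmbed z * ulCorner (Nat.succ_le_succ i.isLt) x =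
          ulCorner (Nat.succ_le_succ i.isLt) x * matEmbed z →
        z = 0) := by
  constructor
  · intro h
    have hLI : ∀ i : Fin (n + 1), LinearIndependent ℂ
        (fun j : Fin ((i : ℕ) + 1) => ulCorner i.isLt x ^ (j : ℕ)) := by
      intro i
      have := h.comp (Sigma.mk i) sigma_mk_injective
      exact LinearIndependent.of_comp (gzE i.isLt) this
    have hmem : ∀ (i : Fin (n+1)) (z : Matrix (Fin ((i : ℕ) + 1)) (Fin ((i : ℕ) + 1)) ℂ),
        z * ulCorner i.isLt x = ulCorner i.isLt x * z →
        gzE i.isLt z ∈ Submodule.span ℂ ((fun p : Σ i : Fin (n + 1), Fin ((i : ℕ) + 1) =>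
          gzE p.1.isLt (ulCorner p.1.isLt x ^ (p.2 : ℕ))) '' {p | p.1 = i}) := by
      intro i z hz
      have hz' : z ∈ matCentralizer (ulCorner i.isLt x) := hz.symm
      rw [← gz_span _ (hLI i)] at hz'
      have := Submodule.mem_map_of_mem (f := gzE i.isLt) hz'
      rw [Submodule.map_span] at this
      refine Submodule.span_mono ?_ this
      rintro _ ⟨_, ⟨j, rfl⟩, rfl⟩
      exact ⟨⟨i, j⟩, rfl, rfl⟩
    refine ⟨hLI, ?_⟩
    intro i z h1 h2
    have m1 := hmem i.castSucc z h1
    have m2 := hmem i.succ (matEmbed z) h2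
    have hE : gzE i.succ.isLt (matEmbed z) = gzE i.castSucc.isLt z := by
      rw [gz_embed]
      exact gzE_comp (Nat.succ_le_succ i.isLt) (Nat.le_succ _) z
    rw [hE] at m2
    have hd := h.disjoint_span_image (s := {p | p.1 = i.castSucc}) (t := {p | p.1 = i.succ}) (by
      rw [Set.disjoint_left]
      intro p hp hp'
      have := hp.symm.trans hp'
      exact absurd this (Fin.castSucc_lt_succ).ne)
    have := Submodule.disjoint_def.1 hd _ m1 m2
    exact gzE_inj _ (this.trans (map_zero _).symm)
  · rintro ⟨hLI, hc⟩
    rw [Fintype.linearIndependent_iff]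
    intro g hg
    let z : ∀ i : Fin (n+1), Matrix (Fin ((i : ℕ) + 1)) (Fin ((i : ℕ) + 1)) ℂ :=
      fun i => ∑ j : Fin ((i : ℕ) + 1), g ⟨i, j⟩ • ulCorner i.isLt x ^ (j : ℕ)
    have hzc : ∀ i, ulCorner i.isLt x * z i = z i * ulCorner i.isLt x := by
      intro i
      change z i ∈ matCentralizer (ulCorner i.isLt x)
      exact Submodule.sum_mem _ fun j _ => Submodule.smul_mem _ _ (gz_pow_mem _ _)
    have hsum : ∑ i, gzE i.isLt (z i) = 0 := by
      rw [Fintype.sum_sigma] at hg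
      rw [← hg]
      refine Finset.sum_congr rfl fun i _ => ?_
      simp [z, map_sum]
    have hz : ∀ k : ℕ, ∀ hk : k < n + 1, z ⟨k, hk⟩ = 0 := by
      intro k
      induction k using Nat.strong_induction_on with
      | _ k ih =>
      intro hk
      by_cases hkn : k = n
      · have : ∑ i, gzE i.isLt (z i) = gzE hk (z ⟨k, hk⟩) := by
          rw [Finset.sum_eq_single ⟨k, hk⟩]
          · intro i _ hi
            have hi' : (i : ℕ) ≠ k := fun h => hi (Fin.ext h)
            rw [ih i (by have := i.isLt; omega) i.isLt, map_zero]
          · simp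
        rw [this] at hsum
        exact gzE_inj _ (hsum.trans (map_zero _).symm)
      · have hkn' : k < n := by omega
        have hk2 : k + 2 ≤ n + 1 := by omega
        have h0 : ∑ i : Fin (n+1), ulCorner hk2 (gzE i.isLt (z i) * x - x * gzE i.isLt (z i)) = 0 := by
          have : ∑ i : Fin (n+1), ulCorner hk2 (gzE i.isLt (z i) * x - x * gzE i.isLt (z i))
            = ulCorner hk2 ((∑ i : Fin (n+1), gzE i.isLt (z i)) * x - x * ∑ i : Fin (n+1), gzE i.isLt (z i)) := by
            simp only [gz_corner, Matrix.sum_mul, Matrix.mul_sum, ← Finset.sum_sub_distrib]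
          rw [this, hsum, gz_corner]
          simp
        rw [Finset.sum_eq_single ⟨k, hk⟩] at h0
        · have h1 := gz_bracket_small hk2 (Nat.le_succ (k+1)) x (z ⟨k, hk⟩)
          apply hc ⟨k, hkn'⟩
          · exact (hzc ⟨k, hk⟩).symm
          · rw [gz_embed]
            exact sub_eq_zero.1 (h1.symm.trans h0)
        · intro i _ hi
          have hi' : (i : ℕ) ≠ k := fun h => hi (Fin.ext h)
          rcases lt_or_gt_of_ne hi' with hlt | hgt
          · rw [ih i hlt i.isLt, map_zero, gz_corner]; simp
          · exact gz_bracket_large i.isLt (by omega : k + 2 ≤ (i : ℕ) + 1) x (z i) (hzc i)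
        · simp
    rintro ⟨i, j⟩
    exact Fintype.linearIndependent_iff.1 (hLI i) (fun j => g ⟨i, j⟩) (hz i i.isLt) j

lemma gz_deriv_abs {A : Type*} [NormedRing A] [NormedAlgebra ℂ A] [FiniteDimensional ℂ A]
    (T : A →ₗ[ℂ] ℂ) (hT : ∀ a b, T (a * b) = T (b * a)) (a b : A) (j : ℕ) :
    HasDerivAt (fun t : ℂ => T ((a + t • b) ^ (j + 1))) ((j + 1 : ℂ) * T (a ^ j * b)) 0 := by
  have h1 : HasDerivAt (fun t : ℂ => a + t • b) b 0 := by
    have := ((hasDerivAt_id (0 : ℂ)).smul_const b).const_add a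
    rw [one_smul] at this
    exact this
  have h2 := h1.fun_pow' (j + 1)
  have h3 := (LinearMap.toContinuousLinearMap T).hasFDerivAt.comp_hasDerivAt (0 : ℂ) h2
  refine HasDerivAt.congr_deriv h3 ?_
  rw [map_sum]
  have : ∀ i ∈ Finset.range (j + 1), LinearMap.toContinuousLinearMap T
      ((a + (0:ℂ) • b) ^ ((j+1).pred - i) * b * (a + (0:ℂ) • b) ^ i) = T (a ^ j * b) := by
    intro i hi
    have hi := Finset.mem_range.1 hi
    change T _ = _
    rw [hT, ← mul_assoc, ← pow_add]
    simp only [zero_smul, add_zero]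
    congr 3
    simp only [Nat.pred_succ]
    omega
  rw [Finset.sum_congr rfl this]
  simp

lemma gz_deriv {k : ℕ} (a b : Matrix (Fin k) (Fin k) ℂ) (j : ℕ) :
    HasDerivAt (fun t : ℂ => ((a + t • b) ^ (j + 1)).trace) ((j + 1 : ℂ) * (a ^ j * b).trace) 0 :=
  @gz_deriv_abs (Matrix (Fin k) (Fin k) ℂ) Matrix.linftyOpNormedRing Matrix.linftyOpNormedAlgebra
    (inferInstanceAs (FiniteDimensional ℂ (Matrix (Fin k) (Fin k) ℂ)))
    (Matrix.traceLinearMap (Fin k) ℂ ℂ) (fun a b => Matrix.trace_mul_comm a b) a b j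

lemma gz_diff {m k : ℕ} (h : k ≤ m) (j : ℕ) :
    Differentiable ℂ (fun y : Matrix (Fin m) (Fin m) ℂ => ((ulCorner h y) ^ j).trace) := by
  have key : ∀ j : ℕ, ∀ a b, Differentiable ℂ
      (fun y : Matrix (Fin m) (Fin m) ℂ => ((ulCorner h y) ^ j) a b) := by
    intro j
    induction j with
    | zero => intro a b; simp
    | succ j ih =>
      intro a b
      simp only [pow_succ, Matrix.mul_apply]
      refine Differentiable.fun_sum fun c _ => (ih a c).mul ?_
      let L : Matrix (Fin m) (Fin m) ℂ →ₗ[ℂ] ℂ := Matrix.entryLinearMap ℂ ℂ (Fin.castLE h c) (Fin.castLE h b)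
      exact (LinearMap.toContinuousLinearMap L).differentiable
  simp only [Matrix.trace, Matrix.diag]
  exact Differentiable.fun_sum fun c _ => key j c c

lemma gz_fderiv {m k : ℕ} (h : k ≤ m) (j : ℕ) (x v : Matrix (Fin m) (Fin m) ℂ) :
    fderiv ℂ (fun y : Matrix (Fin m) (Fin m) ℂ => ((ulCorner h y) ^ (j + 1)).trace) x v =
      (j + 1 : ℂ) * (gzE h (ulCorner h x ^ j) * v).trace := by
  rw [gz_trace]
  refine ((gz_diff h (j + 1) x).lineDeriv_eq_fderiv (v := v)).symm.trans ?_
  exact (gz_deriv (ulCorner h x) (ulCorner h v) j).deriv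

/-- trace form -/
noncomputable def gzT (m : ℕ) : Matrix (Fin m) (Fin m) ℂ →ₗ[ℂ] (Matrix (Fin m) (Fin m) ℂ →L[ℂ] ℂ) where
  toFun z := LinearMap.toContinuousLinearMap
    (Matrix.traceLinearMap (Fin m) ℂ ℂ ∘ₗ LinearMap.mulLeft ℂ z)
  map_add' := by intro a b; ext v; simp [Matrix.add_mul]
  map_smul' := by intro a b; ext v; simp

lemma gzT_apply (m : ℕ) (z v : Matrix (Fin m) (Fin m) ℂ) : gzT m z v = (z * v).trace := rfl

lemma gzT_ker (m : ℕ) : LinearMap.ker (gzT m) = ⊥ := by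
  rw [LinearMap.ker_eq_bot']
  intro z hz
  rw [Matrix.ext_iff_trace_mul_right]
  intro v
  rw [← gzT_apply, hz]
  simp

/-- Kostant–Wallach: `x ∈ gl(n+1,ℂ)` is strongly regular — the differentials at
`x` of the Gelfand–Zeitlin functions `f_{i,j}(y) = Tr((y_i)^j)`, `1 ≤ j ≤ i ≤ n+1`,
are linearly independent — if and only if each corner `x_i` is regular in
`gl(i,ℂ)` (its centralizer has dimension `i`) and
`z_{gl(i)}(x_i) ∩ z_{gl(i+1)}(x_{i+1}) = 0` for `1 ≤ i ≤ n`. -/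
theorem stmt13 (n : ℕ) (x : Matrix (Fin (n + 1)) (Fin (n + 1)) ℂ) :
    LinearIndependent ℂ
      (fun p : Σ i : Fin (n + 1), Fin ((i : ℕ) + 1) =>
        fderiv ℂ (fun y : Matrix (Fin (n + 1)) (Fin (n + 1)) ℂ =>
          Matrix.trace ((ulCorner p.1.isLt y) ^ ((p.2 : ℕ) + 1))) x) ↔
    ((∀ i : Fin (n + 1),
        Module.finrank ℂ (matCentralizer (ulCorner i.isLt x)) = (i : ℕ) + 1) ∧
      ∀ i : Fin n, ∀ z : Matrix (Fin ((i : ℕ) + 1)) (Fin ((i : ℕ) + 1)) ℂ,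
        z * ulCorner (Nat.succ_le_succ i.isLt.le) x =
          ulCorner (Nat.succ_le_succ i.isLt.le) x * z →
        matEmbed z * ulCorner (Nat.succ_le_succ i.isLt) x =
          ulCorner (Nat.succ_le_succ i.isLt) x * matEmbed z →
        z = 0) := by
  have hreg : (∀ i : Fin (n + 1),
        Module.finrank ℂ (matCentralizer (ulCorner i.isLt x)) = (i : ℕ) + 1) ↔
      (∀ i : Fin (n + 1), LinearIndependent ℂ
        (fun j : Fin ((i : ℕ) + 1) => ulCorner i.isLt x ^ (j : ℕ))) :=
    forall_congr' fun i => ⟨gz_finrank_to_LI _, gz_LI_to_finrank _⟩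
  rw [hreg, ← gz_main, ← (gzT (n + 1)).linearIndependent_iff (gzT_ker _)]
  have hne : ∀ p : Σ i : Fin (n + 1), Fin ((i : ℕ) + 1), ((p.2 : ℕ) + 1 : ℂ) ≠ 0 :=
    fun p => Nat.cast_add_one_ne_zero _
  refine Iff.trans ?_ (LinearIndependent.units_smul_iff _ (fun p => Units.mk0 _ (hne p)))
  apply iff_of_eq
  congr 1
  funext p
  ext1 v
  exact gz_fderiv p.1.isLt p.2 x v
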